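/- arXiv:2211.08123 — 2 statements merged into one kernel-verified Lean document; each statement's English description precedes it below -/
import Mathlib

section
/- Let G be a finite group and let χ be the character of a finite-dimensional complex representation of G with χ(1) > 0. Then the Knutson index K(χ) is finite (i.e., there exists a positive integer n and a virtual character φ of G with χ·φ = n·ρ_reg), and K(χ) divides χ(1). -/
open scoped ComplexOrder

noncomputable section

/-- `χ : G → ℂ` is an irreducible character: the character of a simple
finite-dimensional complex representation of `G`. -/
def IsIrrChar (G : Type) [Group G] (χ : G → ℂ) : Prop :=
  ∃ V : FDRep ℂ G, CategoryTheory.Simple V ∧ χ = V.character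

/-- A virtual character is a `ℤ`-linear combination of irreducible characters. -/
def IsVirtualChar (G : Type) [Group G] (χ : G → ℂ) : Prop :=
  χ ∈ Submodule.span ℤ {f : G → ℂ | IsIrrChar G f}

open Classical in
/-- The regular character: `|G|` at the identity, `0` elsewhere. -/
def regChar (G : Type) [Group G] : G → ℂ :=
  fun g => if g = 1 then (Nat.card G : ℂ) else 0

/-- The Knutson index of `χ`: the least positive `n` such that `χ·φ = n·ρ_reg`
for some virtual character `φ`. -/
def KnutsonIndex (G : Type) [Group G] (χ : G → ℂ) : ℕ :=
  sInf {n : ℕ | 0 < n ∧ ∃ φ : G → ℂ, IsVirtualChar G φ ∧ χ * φ = n • regChar G}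

/-- `ℂ[G]` is of Knutson type: every irreducible character is regular invertible. -/
def IsKnutsonType (G : Type) [Group G] : Prop :=
  ∀ χ : G → ℂ, IsIrrChar G χ → ∃ φ : G → ℂ, IsVirtualChar G φ ∧ χ * φ = regChar G

/-- Savitskii's preorder: `φ ≤ χ` iff `φ(1) ≤ χ(1)` and every zero of `χ` is a zero of `φ`. -/
def SavitskiiLE (G : Type) [Group G] (φ χ : G → ℂ) : Prop :=
  φ 1 ≤ χ 1 ∧ ∀ g : G, χ g = 0 → φ g = 0

/-- A virtual character of positive degree is Savitskii-minimal if every virtual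
character of positive degree below it is also above it. -/
def SavitskiiMinimal (G : Type) [Group G] (χ : G → ℂ) : Prop :=
  ∀ φ : G → ℂ, IsVirtualChar G φ → 0 < φ 1 → SavitskiiLE G φ χ → SavitskiiLE G χ φ

end

namespace FDRep

open CategoryTheory CategoryTheory.Limits

variable {k : Type} [Field k] {G : Type} [Group G]

/-- The character of a biproduct, in terms of its inclusions and projections, is the sum of the
characters of the summands. -/
lemma character_eq_add {U V W : FDRep k G} (i : U ⟶ V) (p : V ⟶ U) (j : W ⟶ V) (q : V ⟶ W)
    (hip : i ≫ p = 𝟙 U) (hjq : j ≫ q = 𝟙 W) (htotal : p ≫ i + q ≫ j = 𝟙 V) :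
    V.character = U.character + W.character := by
  have summand {X : FDRep k G} (a : X ⟶ V) (b : V ⟶ X) (hab : a ≫ b = 𝟙 X) (g : G) :
      LinearMap.trace k V (V.ρ g ∘ₗ (b ≫ a).hom.hom.hom) = X.character g := by
    have hcomm : V.ρ g ∘ₗ a.hom.hom.hom = a.hom.hom.hom ∘ₗ X.ρ g :=
      congrArg (fun f ↦ f.hom.hom) (a.comm g).symm
    have hinv : b.hom.hom.hom ∘ₗ a.hom.hom.hom = LinearMap.id :=
      congrArg (fun f ↦ f.hom.hom.hom) hab
    change LinearMap.trace k V (V.ρ g ∘ₗ a.hom.hom.hom ∘ₗ b.hom.hom.hom) = _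
    rw [← LinearMap.comp_assoc, hcomm, LinearMap.trace_comp_comm', ← LinearMap.comp_assoc, hinv,
      LinearMap.id_comp, character]
  have hid : (p ≫ i).hom.hom.hom + (q ≫ j).hom.hom.hom = LinearMap.id :=
    congrArg (fun f ↦ f.hom.hom.hom) htotal
  ext g
  rw [Pi.add_apply, ← summand i p hip, ← summand j q hjq, ← map_add, ← LinearMap.comp_add, hid,
    LinearMap.comp_id, character]

lemma isZero_of_finrank_eq_zero (V : FDRep k G) (h : Module.finrank k V = 0) : IsZero V := by
  have : Subsingleton V := Module.finrank_zero_iff.mp h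
  rw [IsZero.iff_id_eq_zero]
  ext x
  exact Subsingleton.elim (α := V) _ _

/-- A retract of a representation has a complement. -/
lemma exists_complement {U V : FDRep k G} (i : U ⟶ V) (p : V ⟶ U) (hip : i ≫ p = 𝟙 U) :
    ∃ (W : FDRep k G) (j : W ⟶ V) (q : V ⟶ W), j ≫ q = 𝟙 W ∧ p ≫ i + q ≫ j = 𝟙 V := by
  have h : (𝟙 V - p ≫ i) ≫ p = 0 := by simp [hip]
  refine ⟨kernel p, kernel.ι p, kernel.lift p _ h, ?_, by simp⟩
  simp [← cancel_mono (kernel.ι p)]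

/-- A nonzero representation that is not simple is a direct sum of two smaller ones. -/
lemma exists_character_eq_add_of_not_simple [Finite G] [CharZero k]
    (V : FDRep k G) (hV : ¬ Simple V) (hpos : Module.finrank k V ≠ 0) :
    ∃ U W : FDRep k G, Module.finrank k U < Module.finrank k V ∧
      Module.finrank k W < Module.finrank k V ∧ V.character = U.character + W.character := by
  obtain ⟨U, i, _, hi, hi0⟩ : ∃ (U : FDRep k G) (i : U ⟶ V), Mono i ∧ ¬ IsIso i ∧ i ≠ 0 := by
    by_contra! H
    refine hV ⟨fun {U} i _ ↦ ⟨?_, fun h0 ↦ by_contra fun h ↦ h0 (H U i inferInstance h)⟩⟩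
    rintro hiso rfl
    have hz : 𝟙 V = 0 := by rw [← IsIso.inv_hom_id (0 : U ⟶ V), comp_zero]
    have hid : (LinearMap.id : V →ₗ[k] V) = 0 := congrArg (fun f ↦ f.hom.hom.hom) hz
    refine hpos (Module.finrank_zero_iff.mpr ⟨fun x y ↦ ?_⟩)
    rw [← LinearMap.id_apply (R := k) x, ← LinearMap.id_apply (R := k) y, hid]
    rfl
  have hip := Injective.comp_factorThru (𝟙 U) i
  obtain ⟨W, j, q, hjq, htotal⟩ := exists_complement i _ hip
  have hchar := character_eq_add i _ j q hip hjq htotal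
  have hdim : Module.finrank k V = Module.finrank k U + Module.finrank k W := by
    have h1 := congrFun hchar 1
    rw [Pi.add_apply, char_one, char_one, char_one] at h1
    exact_mod_cast h1
  have hU : Module.finrank k U ≠ 0 := fun h ↦
    hi0 ((isZero_of_finrank_eq_zero U h).eq_zero_of_src i)
  have hW : Module.finrank k W ≠ 0 := fun h ↦ by
    rw [(isZero_of_finrank_eq_zero W h).eq_zero_of_src j, comp_zero, add_zero] at htotal
    exact hi ⟨_, hip, htotal⟩
  exact ⟨U, W, by omega, by omega, hchar⟩

end FDRep

/-- The character of any finite-dimensional representation of a finite group is virtual. -/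
lemma isVirtualChar_character {G : Type} [Group G] [Finite G] (V : FDRep ℂ G) :
    IsVirtualChar G V.character := by
  induction hn : Module.finrank ℂ V using Nat.strong_induction_on generalizing V with
  | _ n ih =>
    by_cases hV : CategoryTheory.Simple V
    · exact Submodule.subset_span ⟨V, hV, rfl⟩
    by_cases hpos : Module.finrank ℂ V = 0
    · have : Subsingleton V := Module.finrank_zero_iff.mp hpos
      have h0 : V.character = 0 := by
        ext g
        rw [FDRep.character, Subsingleton.elim (V.ρ g) 0, map_zero, Pi.zero_apply]
      exact h0 ▸ Submodule.zero_mem _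
    obtain ⟨U, W, hU, hW, hchar⟩ := V.exists_character_eq_add_of_not_simple hV hpos
    exact hchar ▸ Submodule.add_mem _ (ih _ (hn ▸ hU) U rfl) (ih _ (hn ▸ hW) W rfl)

/-- The character of the regular representation is the regular character. -/
lemma character_leftRegular {G : Type} [Group G] [Finite G] :
    (FDRep.of (Representation.leftRegular ℂ G)).character = regChar G := by
  classical
  have := Fintype.ofFinite G
  ext g
  change LinearMap.trace ℂ (MonoidAlgebra ℂ G) (Representation.leftRegular ℂ G g) = _
  rw [LinearMap.trace_eq_matrix_trace ℂ (.ofRepr (MonoidAlgebra.coeffLinearEquiv ℂ)), Matrix.trace]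
  simp [LinearMap.toMatrix_apply, regChar, Finsupp.single_apply, Nat.card_eq_fintype_card]

lemma isVirtualChar_regChar (G : Type) [Group G] [Finite G] : IsVirtualChar G (regChar G) :=
  character_leftRegular (G := G) ▸ isVirtualChar_character _

lemma mul_regChar {G : Type} [Group G] (χ : G → ℂ) : χ * regChar G = χ 1 • regChar G := by
  ext g
  by_cases hg : g = 1 <;> simp [regChar, hg]

/-- The Knutson index divides every multiplier of the regular character. -/
lemma knutsonIndex_dvd {G : Type} [Group G] {χ φ : G → ℂ} {n : ℕ} (hn : 0 < n)
    (hφ : IsVirtualChar G φ) (h : χ * φ = n • regChar G) : KnutsonIndex G χ ∣ n := by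
  obtain ⟨hpos, ψ, hψ, hχψ⟩ : 0 < KnutsonIndex G χ ∧
      ∃ ψ, IsVirtualChar G ψ ∧ χ * ψ = KnutsonIndex G χ • regChar G :=
    Nat.sInf_mem (s := {n | 0 < n ∧ ∃ φ, IsVirtualChar G φ ∧ χ * φ = n • regChar G})
      ⟨n, hn, φ, hφ, h⟩
  set m := KnutsonIndex G χ with hm
  by_contra hdvd
  refine (Nat.mod_lt n hpos).not_ge (hm ▸ Nat.sInf_le
    ⟨Nat.pos_of_ne_zero fun h0 ↦ hdvd (Nat.dvd_of_mod_eq_zero h0), φ - (n / m) • ψ,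
      Submodule.sub_mem _ hφ (Submodule.smul_of_tower_mem _ (n / m) hψ), ?_⟩)
  rw [mul_sub, mul_smul_comm, h, hχψ, smul_smul, sub_eq_iff_eq_add, ← add_smul, mul_comm (n / m),
    Nat.mod_add_div]

/-- The Knutson index of the character `χ` of a finite-dimensional
complex representation of a finite group `G` with `χ(1) > 0` is finite, and it
divides `χ(1) = dim V`. -/
theorem knutson_index_finite_and_dvd_degree {G : Type} [Group G] [Finite G]
    (V : FDRep ℂ G) (χ : G → ℂ) (hχ : χ = V.character)
    (hpos : 0 < Module.finrank ℂ V) :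
    (∃ n : ℕ, 0 < n ∧ ∃ φ : G → ℂ, IsVirtualChar G φ ∧ χ * φ = n • regChar G) ∧
    KnutsonIndex G χ ∣ Module.finrank ℂ V := by
  have h : χ * regChar G = Module.finrank ℂ V • regChar G := by
    rw [mul_regChar, hχ, FDRep.char_one, Nat.cast_smul_eq_nsmul]
  exact ⟨⟨_, hpos, _, isVirtualChar_regChar G, h⟩,
    knutsonIndex_dvd hpos (isVirtualChar_regChar G) h⟩
end

section
/- Let G and H be finite groups, χ the character of a finite-dimensional complex representation of G with χ(1) > 0, and ψ the character of a finite-dimensional complex representation of H with ψ(1) > 0. Let χ⊠ψ denote the character of the external tensor product, i.e., the character of G×H given by (χ⊠ψ)(g,h) = χ(g)·ψ(h). Then max(K(χ), K(ψ)) ≤ K(χ⊠ψ) ≤ K(χ)·K(ψ). -/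
open scoped ComplexOrder

open Representation in
/-- An irreducible complex representation of a finite group has an irreducible character. -/
lemma isIrrChar_of_isIrreducible {G V : Type} [Group G] [Finite G] [AddCommGroup V] [Module ℂ V]
    [FiniteDimensional ℂ V] (ρ : Representation ℂ G V) [IsIrreducible ρ] :
    IsIrrChar G ρ.character := by
  have := Fintype.ofFinite G
  have hG : (Nat.card G : ℂ) ≠ 0 := Nat.cast_ne_zero.mpr Nat.card_pos.ne'
  have := invertibleOfNonzero hG
  refine ⟨FDRep.of ρ, ?_, rfl⟩
  rw [FDRep.simple_iff_char_is_norm_one]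
  have h := char_orthonormal ρ ρ
  rw [if_pos ⟨Representation.Equiv.refl ρ⟩, inv_mul_eq_one₀ hG] at h
  exact h.symm

/-- The trace of a representation splits over a pair of complementary subrepresentations. -/
lemma Subrepresentation.character_add_of_isCompl {k G V : Type*} [Field k] [Monoid G]
    [AddCommGroup V] [Module k V] [FiniteDimensional k V] {ρ : Representation k G V}
    {σ τ : Subrepresentation ρ} (h : IsCompl σ.toSubmodule τ.toSubmodule) :
    ρ.character = σ.toRepresentation.character + τ.toRepresentation.character := by
  ext g
  let e := Submodule.prodEquivOfIsCompl _ _ h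
  have key : ρ g = e.conj ((σ.toRepresentation g).prodMap (τ.toRepresentation g)) := by
    ext v
    obtain ⟨x, rfl⟩ := e.surjective v
    simp [LinearEquiv.conj_apply, e, Subrepresentation.toRepresentation]
  rw [Pi.add_apply, Representation.character, key, LinearMap.trace_conj',
    LinearMap.trace_prodMap']
  rfl

open Representation in
/-- The character of a finite-dimensional representation of a finite group is a virtual
character. -/
lemma isVirtualChar_character_s1 {G V : Type} [Group G] [Finite G] [AddCommGroup V] [Module ℂ V]
    [FiniteDimensional ℂ V] (ρ : Representation ℂ G V) : IsVirtualChar G ρ.character := by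
  induction hn : Module.finrank ℂ V using Nat.strong_induction_on generalizing V with
  | _ n ih =>
  subst hn
  by_cases hirr : IsIrreducible ρ
  · exact Submodule.subset_span (isIrrChar_of_isIrreducible ρ)
  rcases subsingleton_or_nontrivial V with hV | hV
  · have : ρ.character = 0 := by
      ext g
      rw [Representation.character, Subsingleton.elim (ρ g) 0, map_zero, Pi.zero_apply]
    rw [this]
    exact Submodule.zero_mem _
  obtain ⟨σ, hσ⟩ : ∃ σ : Subrepresentation ρ, σ ≠ ⊥ ∧ σ ≠ ⊤ := by
    by_contra! h
    have : Nontrivial (Subrepresentation ρ) :=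
      ⟨⊥, ⊤, fun hbt ↦ bot_ne_top (α := Submodule ℂ V) (congrArg (·.toSubmodule) hbt)⟩
    exact hirr ⟨fun σ ↦ or_iff_not_imp_left.mpr (h σ)⟩
  have : NeZero (Nat.card G : ℂ) := ⟨Nat.cast_ne_zero.mpr Nat.card_pos.ne'⟩
  obtain ⟨τ, hτ⟩ := exists_isCompl σ
  have hc : IsCompl σ.toSubmodule τ.toSubmodule := by
    rw [isCompl_iff, disjoint_iff, codisjoint_iff] at hτ ⊢
    exact ⟨congrArg (·.toSubmodule) hτ.1, congrArg (·.toSubmodule) hτ.2⟩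
  have hlt (υ : Subrepresentation ρ) (hυ : υ ≠ ⊤) :
      Module.finrank ℂ υ.toSubmodule < Module.finrank ℂ V :=
    Submodule.finrank_lt fun h ↦ hυ (Subrepresentation.toSubmodule_injective h)
  have hτtop : τ ≠ ⊤ := by
    rintro rfl
    exact hσ.1 (by simpa using hτ.inf_eq_bot)
  rw [Subrepresentation.character_add_of_isCompl hc]
  exact Submodule.add_mem _ (ih _ (hlt σ hσ.2) σ.toRepresentation rfl)
    (ih _ (hlt τ hτtop) τ.toRepresentation rfl)

/-- An additive map sending characters of representations to virtual characters sends virtual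
characters to virtual characters. -/
lemma IsVirtualChar.map {G H : Type} [Group G] [Group H] (f : (G → ℂ) →ₗ[ℤ] (H → ℂ))
    (hf : ∀ V : FDRep ℂ G, IsVirtualChar H (f V.character)) {φ : G → ℂ} (hφ : IsVirtualChar G φ) :
    IsVirtualChar H (f φ) := by
  have h : Submodule.span ℤ {f : G → ℂ | IsIrrChar G f} ≤
      (Submodule.span ℤ {f : H → ℂ | IsIrrChar H f}).comap f :=
    Submodule.span_le.mpr fun _ ⟨V, _, hV⟩ ↦ hV ▸ hf V
  exact h hφ

/-- Virtual characters pull back along group homomorphisms. -/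
lemma IsVirtualChar.comp {G H : Type} [Group G] [Group H] [Finite H] (f : H →* G) {φ : G → ℂ}
    (hφ : IsVirtualChar G φ) : IsVirtualChar H (φ ∘ f) :=
  hφ.map (LinearMap.funLeft ℤ ℂ f) fun V ↦ isVirtualChar_character_s1 (V.ρ.comp f)

/-- A product of virtual characters is a virtual character. -/
lemma IsVirtualChar.mul {G : Type} [Group G] [Finite G] {φ ψ : G → ℂ} (hφ : IsVirtualChar G φ)
    (hψ : IsVirtualChar G ψ) : IsVirtualChar G (φ * ψ) := by
  refine hφ.map (LinearMap.mulRight ℤ ψ) fun V ↦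
    hψ.map (LinearMap.mulLeft ℤ V.character) fun W ↦ ?_
  have h := isVirtualChar_character_s1 (Representation.tprod V.ρ W.ρ)
  rwa [Representation.char_tensor] at h

/-- The trace of an endomorphism on an invariant subspace is the trace of its composite with a
projection onto that subspace. -/
lemma LinearMap.IsProj.trace_comp {k V : Type*} [Field k] [AddCommGroup V] [Module k V]
    [FiniteDimensional k V] {p : Submodule k V} {P : V →ₗ[k] V} (hP : LinearMap.IsProj p P)
    (f : V →ₗ[k] V) (hf : ∀ v ∈ p, f v ∈ p) :
    LinearMap.trace k V (f ∘ₗ P) = LinearMap.trace k p (f.restrict hf) := by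
  have h₁ : f ∘ₗ P = (p.subtype ∘ₗ f.restrict hf) ∘ₗ hP.codRestrict := by
    ext v
    rfl
  have h₂ : hP.codRestrict ∘ₗ p.subtype ∘ₗ f.restrict hf = f.restrict hf := by
    ext v
    exact hP.map_id _ (hf v v.2)
  rw [h₁, LinearMap.trace_comp_comm', h₂]

open Representation in
/-- Averaging a virtual character of `G × H` over `H` yields a virtual character of `G`. -/
lemma IsVirtualChar.average {G H : Type} [Group G] [Finite G] [Group H] [Fintype H]
    {Φ : G × H → ℂ} (hΦ : IsVirtualChar (G × H) Φ) :
    IsVirtualChar G (fun g ↦ (Nat.card H : ℂ)⁻¹ * ∑ h, Φ (g, h)) := by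
  let A : (G × H → ℂ) →ₗ[ℤ] (G → ℂ) :=
    { toFun := fun Φ g ↦ (Nat.card H : ℂ)⁻¹ * ∑ h, Φ (g, h)
      map_add' := fun Φ Ψ ↦ by ext g; simp [Finset.sum_add_distrib, mul_add]
      map_smul' := fun n Φ ↦ by ext g; simp [← Finset.mul_sum, mul_left_comm] }
  refine hΦ.map A fun V ↦ ?_
  have := invertibleOfNonzero (a := (Fintype.card H : ℂ))
    (Nat.cast_ne_zero.mpr Fintype.card_ne_zero)
  let σ : Representation ℂ H V := V.ρ.comp (MonoidHom.inr G H)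
  let τ : Representation ℂ G V := V.ρ.comp (MonoidHom.inl G H)
  let S : Subrepresentation τ :=
    ⟨σ.invariants, fun g v hv h ↦ by
      have hc : σ h * τ g = τ g * σ h := by
        simp only [σ, τ, MonoidHom.comp_apply, ← map_mul]
        simp
      calc σ h (τ g v) = τ g (σ h v) := LinearMap.congr_fun hc v
        _ = τ g v := by rw [hv h]⟩
  have hS : A V.character = S.toRepresentation.character := by
    ext g
    refine Eq.trans ?_ (σ.isProj_averageMap.trace_comp (τ g) (S.apply_mem_toSubmodule g))
    have hav : τ g ∘ₗ σ.averageMap = (Nat.card H : ℂ)⁻¹ • ∑ h, V.ρ (g, h) := by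
      have hgh (h : H) : V.ρ (g, h) = τ g ∘ₗ σ h := by
        rw [← Module.End.mul_eq_comp]
        simp only [σ, τ, MonoidHom.comp_apply, ← map_mul]
        simp
      ext v
      simp [averageMap, GroupAlgebra.average, hgh, map_sum]
    rw [hav]
    simp [A, FDRep.character]
  rw [hS]
  exact isVirtualChar_character_s1 _

lemma regChar_prod {G H : Type} [Group G] [Group H] (g : G) (h : H) :
    regChar (G × H) (g, h) = regChar G g * regChar H h := by
  by_cases hg : g = 1 <;> by_cases hh : h = 1 <;> simp [regChar, hg, hh]

/-- The defining property of the Knutson index for a character of positive degree. -/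
lemma knutsonIndex_spec {G : Type} [Group G] [Finite G] (V : FDRep ℂ G)
    (hV : 0 < Module.finrank ℂ V) :
    0 < KnutsonIndex G V.character ∧ ∃ φ : G → ℂ, IsVirtualChar G φ ∧
      V.character * φ = KnutsonIndex G V.character • regChar G := by
  refine Nat.sInf_mem (s := {n : ℕ | 0 < n ∧ ∃ φ : G → ℂ, IsVirtualChar G φ ∧
    V.character * φ = n • regChar G}) ⟨_, hV, regChar G, isVirtualChar_regChar G, ?_⟩
  ext g
  by_cases hg : g = 1 <;> simp [regChar, hg]

lemma knutsonIndex_le {G : Type} [Group G] {χ φ : G → ℂ} {n : ℕ} (hn : 0 < n)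
    (hφ : IsVirtualChar G φ) (h : χ * φ = n • regChar G) : KnutsonIndex G χ ≤ n :=
  Nat.sInf_le ⟨hn, φ, hφ, h⟩

/-- If `χ ⊠ ψ` divides `n` times the regular character of `G × H`, and `ψ` is a virtual character,
then the Knutson index of `χ` is at most `n`. -/
lemma knutsonIndex_le_of_external {G H : Type} [Group G] [Finite G] [Group H] [Finite H]
    {χ : G → ℂ} {ψ : H → ℂ} (hψ : IsVirtualChar H ψ) {n : ℕ} (hn : 0 < n) {Φ : G × H → ℂ}
    (hΦ : IsVirtualChar (G × H) Φ)
    (h : (fun gh : G × H ↦ χ gh.1 * ψ gh.2) * Φ = n • regChar (G × H)) :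
    KnutsonIndex G χ ≤ n := by
  have := Fintype.ofFinite H
  classical
  refine knutsonIndex_le hn ((hψ.comp (MonoidHom.snd G H)).mul hΦ).average ?_
  have hH : (Nat.card H : ℂ) ≠ 0 := Nat.cast_ne_zero.mpr Nat.card_pos.ne'
  ext g
  have hgh (k : H) : χ g * (ψ k * Φ (g, k)) = n * regChar G g * regChar H k := by
    simpa [mul_assoc, regChar_prod] using congrFun h (g, k)
  calc χ g * ((Nat.card H : ℂ)⁻¹ * ∑ k, ψ k * Φ (g, k))
      = (Nat.card H : ℂ)⁻¹ * ∑ k, χ g * (ψ k * Φ (g, k)) := by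
        rw [mul_left_comm, Finset.mul_sum]
    _ = (Nat.card H : ℂ)⁻¹ * (n * regChar G g * Nat.card H) := by
        simp_rw [hgh, ← Finset.mul_sum]
        simp [regChar]
    _ = (n • regChar G) g := by
        rw [mul_comm, mul_inv_cancel_right₀ hH, Pi.smul_apply, nsmul_eq_mul]

/-- For characters `χ` of `G` and `ψ` of `H` of positive degree,
`max (K χ) (K ψ) ≤ K (χ ⊠ ψ) ≤ K χ · K ψ`, where `(χ ⊠ ψ)(g,h) = χ g · ψ h` is the
character of the external tensor product. -/
theorem knutson_index_external_tensor {G H : Type} [Group G] [Finite G] [Group H] [Finite H]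
    (V : FDRep ℂ G) (W : FDRep ℂ H) (χ : G → ℂ) (ψ : H → ℂ)
    (hχ : χ = V.character) (hψ : ψ = W.character)
    (hχpos : 0 < Module.finrank ℂ V) (hψpos : 0 < Module.finrank ℂ W) :
    max (KnutsonIndex G χ) (KnutsonIndex H ψ) ≤
        KnutsonIndex (G × H) (fun gh => χ gh.1 * ψ gh.2) ∧
      KnutsonIndex (G × H) (fun gh => χ gh.1 * ψ gh.2) ≤
        KnutsonIndex G χ * KnutsonIndex H ψ := by
  subst hχ hψ
  obtain ⟨hm, α, hα, hχα⟩ := knutsonIndex_spec V hχpos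
  obtain ⟨hn, β, hβ, hψβ⟩ := knutsonIndex_spec W hψpos
  have hprod : (fun gh : G × H ↦ V.character gh.1 * W.character gh.2) *
      ((α ∘ MonoidHom.fst G H) * (β ∘ MonoidHom.snd G H)) =
      (KnutsonIndex G V.character * KnutsonIndex H W.character) • regChar (G × H) := by
    ext ⟨g, h⟩
    have h₁ := congrFun hχα g
    have h₂ := congrFun hψβ h
    simp only [Pi.mul_apply, Pi.smul_apply, nsmul_eq_mul, Function.comp_apply,
      MonoidHom.coe_fst, MonoidHom.coe_snd] at h₁ h₂ ⊢
    rw [mul_mul_mul_comm, h₁, h₂, regChar_prod, Nat.cast_mul, mul_mul_mul_comm]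
  have hmem := (hα.comp (MonoidHom.fst G H)).mul (hβ.comp (MonoidHom.snd G H))
  refine ⟨?_, knutsonIndex_le (Nat.mul_pos hm hn) hmem hprod⟩
  obtain ⟨hk, Φ, hΦ, h⟩ := Nat.sInf_mem (s := {n : ℕ | 0 < n ∧ ∃ φ : G × H → ℂ,
    IsVirtualChar (G × H) φ ∧ (fun gh : G × H ↦ V.character gh.1 * W.character gh.2) * φ =
      n • regChar (G × H)}) ⟨_, Nat.mul_pos hm hn, _, hmem, hprod⟩
  refine max_le (knutsonIndex_le_of_external (isVirtualChar_character_s1 W.ρ) hk hΦ h)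
    (knutsonIndex_le_of_external (isVirtualChar_character_s1 V.ρ) hk
      (hΦ.comp (MulEquiv.prodComm (M := H) (N := G)).toMonoidHom) ?_)
  ext ⟨b, a⟩
  have hab := congrFun h (a, b)
  simp only [Pi.mul_apply, Pi.smul_apply, regChar_prod] at hab ⊢
  rw [mul_comm (W.character b), mul_comm (regChar H b)]
  exact hab
end
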